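/- arXiv:0706.3716 — 2 statements merged into one kernel-verified Lean document; each statement's English description precedes it below -/
import Mathlib

section
/- Let p ≥ 1 and let J = J({a_k},{b_k}) be a self-adjoint Jacobi matrix (a_k > 0, b_k ∈ ℝ, a_k → 1, b_k → 0). Then every eigenvalue λ(J) of J satisfies, for each choice of sign ±, (λ(J) ∓ 2)_±^p ≤ c_p · Σ_{k=1}^∞ ( (b_k)_±^{p+1/2} + 2|a_k − 1|^{p+1/2} ). -/
/- Golinskii–Kupin, inequality (19): for a self-adjoint Jacobi matrix J and any
   eigenvalue λ(J), for each sign ±,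
   (λ(J) ∓ 2)_±^p ≤ c_p Σ_k ((b_k)_±^{p+1/2} + 2|a_k − 1|^{p+1/2}). -/

open scoped ENNReal

noncomputable section

/-- The Hilbert space ℓ²(ℕ). -/
abbrev l2 : Type := lp (fun _ : ℕ => ℂ) 2

/-- `z` is an eigenvalue of `T`. -/
def HasEigen (T : l2 →L[ℂ] l2) (z : ℂ) : Prop := ∃ u : l2, u ≠ 0 ∧ T u = z • u

/-- `J` is the complex Jacobi matrix with off-diagonal entries `a` and diagonal
entries `b` (`a 0 = a₁, b 0 = b₁`, etc.). -/
def IsJacobi (J : l2 →L[ℂ] l2) (a b : ℕ → ℂ) : Prop :=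
  ∀ u : l2, ∀ k : ℕ,
    (J u : ∀ _ : ℕ, ℂ) k =
      (if k = 0 then 0 else a (k - 1) * (u : ∀ _ : ℕ, ℂ) (k - 1))
      + b k * (u : ∀ _ : ℕ, ℂ) k + a k * (u : ∀ _ : ℕ, ℂ) (k + 1)

/-- The constant c_p. -/
noncomputable def cp (p : ℝ) : ℝ :=
  (1/2) * (3:ℝ) ^ (p - 1/2) * (Real.Gamma (p+1) / Real.Gamma (p+3/2)) *
    (Real.Gamma 2 / Real.Gamma (3/2))


lemma jac_shift {f : ℕ → ℝ} (hf : Summable f) (h0 : f 0 = 0) :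
    ∑' k, f (k+1) = ∑' k, f k := by
  rw [hf.tsum_eq_zero_add, h0, zero_add]

lemma jac_sup (V : ℕ → ℝ) (h0 : V 0 = 0) (hs : Summable fun k => V k ^ 2)
    (hd : Summable fun k => (V (k+1) - V k) ^ 2) (ε : ℝ) (hε : 0 < ε) (n : ℕ) :
    2 * V n ^ 2 ≤ (∑' k, (V (k+1) - V k) ^ 2) / ε + ε * ∑' k, V k ^ 2 := by
  set g : ℕ → ℝ := fun k => (V (k+1) - V k) ^ 2 / ε + ε * ((V (k+1) ^ 2 + V k ^ 2) / 2) with hg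
  have hs1 : Summable fun k => V (k+1) ^ 2 := (summable_nat_add_iff 1).2 hs
  have hgs : Summable g := (hd.div_const ε).add (((hs1.add hs).div_const 2).mul_left ε)
  have hg0 : ∀ k, 0 ≤ g k := fun k => by simp only [hg]; positivity
  have hgt : ∑' k, g k = (∑' k, (V (k+1) - V k) ^ 2) / ε + ε * ∑' k, V k ^ 2 := by
    simp only [hg]
    rw [(hd.div_const ε).tsum_add (((hs1.add hs).div_const 2).mul_left ε), tsum_div_const,
      tsum_mul_left, tsum_div_const, hs1.tsum_add hs,
      jac_shift (f := fun k => V k ^ 2) hs (by simp [h0])]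
    ring
  have key : ∀ k, |V (k+1) ^ 2 - V k ^ 2| ≤ g k := by
    intro k
    have e : g k = ((V (k+1) - V k) / ε) ^ 2 * ε + ε * ((V (k+1) ^ 2 + V k ^ 2) / 2) := by
      simp only [hg]; field_simp
    obtain ⟨y, hy⟩ : ∃ y, y = (V (k+1) - V k) / ε := ⟨_, rfl⟩
    have hx : V (k+1) = V k + ε * y := by rw [hy]; field_simp; ring
    rw [e, ← hy, hx]
    have e2 : (V k + ε * y) ^ 2 - V k ^ 2 = ε * (y * (2 * V k + ε * y)) := by ring
    have e3 : y ^ 2 * ε + ε * (((V k + ε * y) ^ 2 + V k ^ 2) / 2)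
      = ε * (y ^ 2 + ((V k + ε * y) ^ 2 + V k ^ 2) / 2) := by ring
    rw [e2, e3, abs_mul, abs_of_pos hε]
    apply mul_le_mul_of_nonneg_left _ hε.le
    rw [abs_le]
    constructor
    · nlinarith [sq_nonneg (2 * y + (2 * V k + ε * y)), sq_nonneg (ε * y)]
    · nlinarith [sq_nonneg (2 * y - (2 * V k + ε * y)), sq_nonneg (ε * y)]
  have h1 : ∀ m, V m ^ 2 ≤ ∑ k ∈ Finset.range m, g k := by
    intro m
    induction m with
    | zero => simp [h0]
    | succ m ih =>
      rw [Finset.sum_range_succ]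
      linarith [(abs_le.1 (key m)).2]
  have h2 : ∀ m, 2 * V n ^ 2 - V (n+m) ^ 2 ≤ ∑ k ∈ Finset.range (n+m), g k := by
    intro m
    induction m with
    | zero => simp only [add_zero]; linarith [h1 n]
    | succ m ih =>
      rw [← add_assoc, Finset.sum_range_succ]
      linarith [(abs_le.1 (key (n+m))).1]
  rw [← hgt]
  have h3 : ∀ m, 2 * V n ^ 2 - V (m+n) ^ 2 ≤ ∑' k, g k := fun m => by
    rw [add_comm m n]
    exact (h2 m).trans (hgs.sum_le_tsum _ (fun i _ => hg0 i))
  have h4 : Filter.Tendsto (fun m => 2 * V n ^ 2 - V (m+n) ^ 2) Filter.atTop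
      (nhds (2 * V n ^ 2 - 0)) :=
    tendsto_const_nhds.sub ((Filter.tendsto_add_atTop_iff_nat n).2 hs.tendsto_atTop_zero)
  have := le_of_tendsto' h4 h3
  simpa using this

set_option maxHeartbeats 2000000 in
lemma jac_energy (V D W X : ℕ → ℝ) (h0 : V 0 = 0) (hV : ∀ k, 0 ≤ V k)
    (hs : Summable fun k => V k ^ 2)
    (hd : Summable fun k => (V (k+1) - V k) ^ 2)
    (hD0 : D 0 = 0) (hD : ∀ k, 0 ≤ D k) (B : ℝ) (hB : ∀ k, D k ≤ B) (L M κ₁ κ₂ : ℝ)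
    (hX : ∀ k, 0 ≤ X k) (hXs : Summable X) (hκ₂ : 0 ≤ κ₂)
    (hM : ∀ k, V k ^ 2 ≤ M)
    (hW : ∀ k, W k ≤ κ₁ + κ₂ * X k)
    (hL : ∀ k, L * V (k+1) ≤ (1 + D k) * V k + (W k - D k - D (k+1)) * V (k+1)
      + (1 + D (k+1)) * V (k+2)) :
    (L - 2) * (∑' k, V k ^ 2) + ∑' k, (V (k+1) - V k) ^ 2
      ≤ κ₁ * (∑' k, V k ^ 2) + κ₂ * M * ∑' k, X k := by
  have hs1 : Summable fun k => V (k+1) ^ 2 := (summable_nat_add_iff 1).2 hs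
  have hc : Summable fun k => V k * V (k+1) := by
    have := (((hs.add hs1).sub hd).div_const 2)
    refine this.congr fun k => ?_
    ring
  have hcc : ∑' k, V k * V (k+1) =
      ((∑' k, V k ^ 2) + (∑' k, V k ^ 2) - ∑' k, (V (k+1) - V k) ^ 2) / 2 := by
    nth_rewrite 2 [← jac_shift (f := fun k => V k ^ 2) hs (by simp [h0])]
    rw [← hs.tsum_add hs1, ← (hs.add hs1).tsum_sub hd, ← tsum_div_const]
    congr 1; ext k; ring
  have hc1 : Summable fun k => V (k+1) * V (k+2) := (summable_nat_add_iff 1).2 hc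
  have hB0 : 0 ≤ B := (hD 0).trans (hB 0)
  have hp : Summable fun k => D k * V k ^ 2 :=
    Summable.of_nonneg_of_le (fun k => mul_nonneg (hD k) (sq_nonneg _))
      (fun k => mul_le_mul_of_nonneg_right (hB k) (sq_nonneg _)) (hs.mul_left B)
  have hq : Summable fun k => D k * V (k+1) ^ 2 :=
    Summable.of_nonneg_of_le (fun k => mul_nonneg (hD k) (sq_nonneg _))
      (fun k => mul_le_mul_of_nonneg_right (hB k) (sq_nonneg _)) (hs1.mul_left B)
  have hp1 : Summable fun k => D (k+1) * V (k+1) ^ 2 := (summable_nat_add_iff 1).2 hp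
  have hq1 : Summable fun k => D (k+1) * V (k+2) ^ 2 := (summable_nat_add_iff 1).2 hq
  have e1 := jac_shift (f := fun k => V k ^ 2) hs (by simp [h0])
  have e2 := jac_shift (f := fun k => V k * V (k+1)) hc (by simp [h0])
  have e3 := jac_shift (f := fun k => D k * V k ^ 2) hp (by simp [h0])
  have e4 := jac_shift (f := fun k => D k * V (k+1) ^ 2) hq (by simp [hD0])
  have pw : ∀ k, L * V (k+1) ^ 2 ≤ V k * V (k+1) + V (k+1) * V (k+2)
      + (D k * V k ^ 2 - D (k+1) * V (k+1) ^ 2) / 2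
      + (D (k+1) * V (k+2) ^ 2 - D k * V (k+1) ^ 2) / 2
      + (κ₁ * V (k+1) ^ 2 + κ₂ * M * X k) := by
    intro k
    have a1 := mul_le_mul_of_nonneg_right (hL k) (hV (k+1))
    have a2 := mul_le_mul_of_nonneg_right (hW k) (sq_nonneg (V (k+1)))
    have a3 := mul_le_mul_of_nonneg_left (hM (k+1)) (mul_nonneg hκ₂ (hX k))
    have a4 := mul_nonneg (hD k) (sq_nonneg (V k - V (k+1)))
    have a5 := mul_nonneg (hD (k+1)) (sq_nonneg (V (k+2) - V (k+1)))
    linarith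
  have R1 := (hc.hasSum.add hc1.hasSum).add ((hp.hasSum.sub hp1.hasSum).div_const 2)
  have R2 := R1.add ((hq1.hasSum.sub hq.hasSum).div_const 2)
  have R3 := R2.add ((hs1.hasSum.mul_left κ₁).add (hXs.hasSum.mul_left (κ₂ * M)))
  have R := hasSum_le pw (hs1.hasSum.mul_left L) R3
  clear R1 R2 R3 pw hL hW hM
  have e2' : ∑' k, V (k+1) * V (k+2) = ∑' k, V k * V (k+1) := e2
  have e4' : ∑' k, D (k+1) * V (k+2) ^ 2 = ∑' k, D k * V (k+1) ^ 2 := e4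
  rw [e1, e2', e3, e4', hcc] at R
  linarith

lemma jac_gamma (p : ℝ) (hp : 1 ≤ p) :
    ∃ G : ℝ, 0 < G ∧ cp p = 3 ^ (p - 1/2) * G ∧ 1 ≤ G ^ 2 * (Real.pi * (p + 1)) := by
  have hg1 : 0 < Real.Gamma (p+1) := Real.Gamma_pos_of_pos (by linarith)
  have hg3 : 0 < Real.Gamma (p+3/2) := Real.Gamma_pos_of_pos (by linarith)
  have h32 : Real.Gamma (3/2) = √Real.pi / 2 := by
    rw [show (3/2 : ℝ) = 1/2 + 1 by norm_num, Real.Gamma_add_one (by norm_num),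
      Real.Gamma_one_half_eq]; ring
  have hpi : 0 < √Real.pi := Real.sqrt_pos.2 Real.pi_pos
  refine ⟨Real.Gamma (p+1) / Real.Gamma (p+3/2) / √Real.pi, by positivity, ?_, ?_⟩
  · rw [cp, h32, Real.Gamma_two]; field_simp
  · have h := Real.Gamma_mul_add_mul_le_rpow_Gamma_mul_rpow_Gamma (s := p+1) (t := p+1+1)
      (a := 1/2) (b := 1/2) (by linarith) (by linarith) (by norm_num) (by norm_num) (by norm_num)
    rw [show (1/2 * (p+1) + 1/2 * (p+1+1) : ℝ) = p + 3/2 by ring,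
      Real.Gamma_add_one (s := p+1) (by linarith), ← Real.sqrt_eq_rpow, ← Real.sqrt_eq_rpow,
      ← Real.sqrt_mul hg1.le] at h
    have h2 := pow_le_pow_left₀ hg3.le h 2
    rw [Real.sq_sqrt (by positivity)] at h2
    rw [div_pow, div_pow, Real.sq_sqrt Real.pi_pos.le]
    have := Real.pi_pos
    rw [show Real.Gamma (p+1) ^ 2 / Real.Gamma (p+3/2) ^ 2 / Real.pi * (Real.pi * (p+1))
      = (Real.Gamma (p+1) * ((p+1) * Real.Gamma (p+1))) / Real.Gamma (p+3/2) ^ 2 by field_simp]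
    rw [le_div_iff₀ (by positivity)]
    linarith

lemma jac_young (r τ w : ℝ) (hr : 1 ≤ r) (hτ : 0 < τ) (hw : 0 ≤ w) :
    w ≤ (1 - 1/r) * τ + (τ / τ ^ r / r) * w ^ r := by
  have h := one_add_mul_self_le_rpow_one_add (s := w/τ - 1) (p := r)
    (by have : 0 ≤ w / τ := by positivity
        linarith) hr
  rw [add_sub_cancel, Real.div_rpow hw hτ.le] at h
  have hr0 : 0 < r := by linarith
  have h2 := mul_le_mul_of_nonneg_left h (show 0 ≤ τ / r by positivity)
  have e1 : τ / r * (1 + r * (w/τ - 1)) = w - (1 - 1/r) * τ := by field_simp; ring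
  have e2 : τ / r * (w ^ r / τ ^ r) = (τ / τ ^ r / r) * w ^ r := by field_simp
  rw [e1, e2] at h2
  linarith

lemma jac_core (p : ℝ) (hp : 1 ≤ p) (E Q T S G : ℝ) (hE : 0 < E) (hQ : 0 < Q) (hS : 0 < S)
    (hG : 0 < G) (hG1 : 1 ≤ G ^ 2 * (Real.pi * (p + 1)))
    (H : ∀ τ ε : ℝ, 0 < τ → 0 < ε → E * Q + T ≤ (1 - 1/(p+1/2)) * τ * Q
      + τ / τ ^ (p+1/2) / (p+1/2) * ((T / ε + ε * Q) / 2) * S) :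
    E ^ p ≤ G * S := by
  have hp0 : 0 < p := by linarith
  obtain ⟨r, hr⟩ : ∃ r, r = p + 1/2 := ⟨_, rfl⟩
  have hr0 : 0 < r := by linarith
  rw [← hr] at H
  obtain ⟨τ, hτ⟩ : ∃ τ, τ = E * (r / p) := ⟨_, rfl⟩
  have hτ0 : 0 < τ := by rw [hτ]; positivity
  have hEτ : E = τ * p / r := by rw [hτ]; field_simp
  obtain ⟨κ, hκ⟩ : ∃ κ, κ = τ / τ ^ r / r := ⟨_, rfl⟩
  have hκ0 : 0 < κ := by rw [hκ]; positivity
  have h := H τ (κ * S / 2) hτ0 (by positivity)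
  rw [← hκ, show κ * ((T / (κ * S / 2) + κ * S / 2 * Q) / 2) * S = T + (κ * S / 2) ^ 2 * Q by
    field_simp] at h
  have h1 : E ≤ (1 - 1/r) * τ + (κ * S / 2) ^ 2 := by
    refine le_of_mul_le_mul_right ?_ hQ
    linarith
  obtain ⟨y, hy⟩ : ∃ y, y = τ ^ p := ⟨_, rfl⟩
  have hy0 : 0 < y := by rw [hy]; positivity
  have hτr : (τ ^ r) ^ 2 = y ^ 2 * τ := by
    rw [hr, Real.rpow_add hτ0, mul_pow, ← Real.sqrt_eq_rpow, Real.sq_sqrt hτ0.le, hy]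
  have hκ2 : κ ^ 2 = τ / (y ^ 2 * r ^ 2) := by
    rw [hκ, div_pow, div_pow, hτr]; field_simp
  have h2 : y ^ 2 * (2 * r) ≤ S ^ 2 := by
    have e1 : E - (1 - 1/r) * τ = τ / (2 * r) := by
      rw [hEτ, hr]; field_simp; ring
    have e2 : (κ * S / 2) ^ 2 = τ * S ^ 2 / (4 * r ^ 2 * y ^ 2) := by
      rw [div_pow, mul_pow, hκ2]; field_simp; norm_num
    have h3 : τ / (2 * r) ≤ τ * S ^ 2 / (4 * r ^ 2 * y ^ 2) := by linarith
    rw [div_le_div_iff₀ (by positivity) (by positivity)] at h3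
    refine le_of_mul_le_mul_left ?_ (show 0 < τ * (2 * r) by positivity)
    nlinarith
  have h4 : 3/2 * E ^ p ≤ y := by
    rw [hy, hτ, Real.mul_rpow hE.le (by positivity), mul_comm]
    apply mul_le_mul_of_nonneg_left _ (by positivity)
    have := one_add_mul_self_le_rpow_one_add (s := 1/(2*p)) (p := p)
      (by have : 0 < 1/(2*p) := by positivity
          linarith) hp
    rw [show 1 + p * (1/(2*p)) = 3/2 by field_simp; norm_num,
      show 1 + 1/(2*p) = r / p by rw [hr]; field_simp] at this
    exact this
  have hEp : 0 < E ^ p := by positivity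
  refine (pow_le_pow_iff_left₀ hEp.le (by positivity) two_ne_zero).1 ?_
  have h5 : (E ^ p) ^ 2 * (9/4) ≤ y ^ 2 := by nlinarith
  have hpi := Real.pi_lt_d2
  have hpi0 := Real.pi_pos
  have h6 : (E ^ p) ^ 2 * (9/4) * (2 * r) ≤ S ^ 2 := by
    refine le_trans ?_ h2
    gcongr
  have h7 : Real.pi * (p+1) ≤ 9/4 * (2 * r) := by rw [hr]; nlinarith
  have h8 : (E ^ p) ^ 2 * (Real.pi * (p+1)) ≤ S ^ 2 := by
    refine le_trans ?_ h6
    rw [mul_assoc]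
    gcongr
  rw [mul_pow]
  have h9 := mul_le_mul_of_nonneg_left h8 (sq_nonneg G)
  have h10 := mul_le_mul_of_nonneg_left hG1 (sq_nonneg (E ^ p))
  linarith

lemma jac_three (r x y z : ℝ) (hr : 1 ≤ r) (hx : 0 ≤ x) (hy : 0 ≤ y) (hz : 0 ≤ z) :
    (x + y + z) ^ r ≤ 3 ^ (r - 1) * (x ^ r + y ^ r + z ^ r) := by
  have h := Real.rpow_sum_le_const_mul_sum_rpow_of_nonneg (Finset.univ : Finset (Fin 3))
    (f := ![x, y, z]) hr (by intro i _; fin_cases i <;> simp [hx, hy, hz])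
  simpa [Fin.sum_univ_three] using h

lemma jac_half (a b v : ℕ → ℝ)
    (ha : Filter.Tendsto a Filter.atTop (nhds 1)) (hv0 : ∀ k, 0 ≤ v k)
    (hvs : Summable fun k => v k ^ 2) (hvne : ∃ k, v k ≠ 0) (L p : ℝ) (hp : 1 ≤ p)
    (hv : ∀ k, L * v k ≤ (if k = 0 then 0 else a (k-1) * v (k-1)) + b k * v k
      + a k * v (k+1)) :
    ENNReal.ofReal ((max (L - 2) 0) ^ p)
      ≤ ENNReal.ofReal (cp p) *
        ∑' k : ℕ, (ENNReal.ofReal ((max (b k) 0) ^ (p + 1/2))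
          + 2 * ENNReal.ofReal (|a k - 1| ^ (p + 1/2))) := by
  obtain ⟨G, hG, hcp, hG1⟩ := jac_gamma p hp
  have hcp0 : 0 < cp p := by rw [hcp]; positivity
  rcases le_or_gt L 2 with hL2 | hL2
  · rw [max_eq_right (by linarith), Real.zero_rpow (by linarith)]; simp
  set Y : ℕ → ℝ := fun k => (max (b k) 0) ^ (p + 1/2) + 2 * |a k - 1| ^ (p + 1/2) with hY
  have hY0 : ∀ k, 0 ≤ Y k := fun k => by simp only [hY]; positivity
  have hterm : ∀ k, ENNReal.ofReal ((max (b k) 0) ^ (p + 1/2))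
          + 2 * ENNReal.ofReal (|a k - 1| ^ (p + 1/2)) = ENNReal.ofReal (Y k) := fun k => by
    simp only [hY]
    rw [ENNReal.ofReal_add (by positivity) (by positivity), ENNReal.ofReal_mul (by norm_num)]
    simp
  simp_rw [hterm]
  by_cases htop : ∑' k, ENNReal.ofReal (Y k) = ⊤
  · rw [htop, ENNReal.mul_top (by simpa using hcp0)]; exact le_top
  have hYs : Summable Y := by
    have := ENNReal.summable_toReal htop
    refine this.congr fun k => ?_
    rw [ENNReal.toReal_ofReal (hY0 k)]
  rw [← ENNReal.ofReal_tsum_of_nonneg hY0 hYs, ← ENNReal.ofReal_mul hcp0.le]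
  apply ENNReal.ofReal_le_ofReal
  rw [max_eq_left (by linarith)]
  set r : ℝ := p + 1/2 with hr
  have hr1 : 1 ≤ r := by linarith
  set V : ℕ → ℝ := fun n => if n = 0 then 0 else v (n-1) with hV
  set D : ℕ → ℝ := fun n => if n = 0 then 0 else |a (n-1) - 1| with hD
  have V0 : V 0 = 0 := by simp [hV]
  have D0 : D 0 = 0 := by simp [hD]
  have V1 : ∀ k, V (k+1) = v k := fun k => by simp [hV]
  have D1 : ∀ k, D (k+1) = |a k - 1| := fun k => by simp [hD]
  have Vn : ∀ k, 0 ≤ V k := fun k => by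
    cases k with
    | zero => rw [V0]
    | succ k => rw [V1]; exact hv0 k
  have Dn : ∀ k, 0 ≤ D k := fun k => by
    cases k with
    | zero => rw [D0]
    | succ k => rw [D1]; positivity
  have Vs : Summable fun k => V k ^ 2 := by
    rw [← summable_nat_add_iff 1]
    simpa only [V1] using hvs
  have Vs1 : Summable fun k => V (k+1) ^ 2 := (summable_nat_add_iff 1).2 Vs
  have Vd : Summable fun k => (V (k+1) - V k) ^ 2 := by
    refine Summable.of_nonneg_of_le (fun k => sq_nonneg _) (fun k => ?_)
      ((Vs1.add Vs).mul_left 2)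
    nlinarith [sq_nonneg (V (k+1) + V k)]
  obtain ⟨B, hB⟩ : ∃ B, ∀ k, D k ≤ B := by
    have h1 : Filter.Tendsto (fun k => |a k - 1|) Filter.atTop (nhds |1 - 1|) :=
      (ha.sub_const 1).abs
    have h2 : Filter.Tendsto D Filter.atTop (nhds |1 - 1|) := by
      rw [← Filter.tendsto_add_atTop_iff_nat 1]
      simpa only [D1] using h1
    obtain ⟨B, hB⟩ := h2.bddAbove_range
    exact ⟨B, fun k => hB ⟨k, rfl⟩⟩
  have Q0 : 0 < ∑' k, V k ^ 2 := by
    obtain ⟨k, hk⟩ := hvne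
    refine Vs.tsum_pos (fun k => sq_nonneg _) (k+1) ?_
    rw [V1]; positivity
  set X : ℕ → ℝ := fun k => 3 ^ (r-1) * ((max (b k) 0) ^ r + D k ^ r + D (k+1) ^ r) with hX
  have X0 : ∀ k, 0 ≤ X k := fun k => by
    have := Dn k
    have := Dn (k+1)
    simp only [hX]; positivity
  have ds1 : Summable fun k => D (k+1) ^ r := by
    refine Summable.of_nonneg_of_le (fun k => Real.rpow_nonneg (Dn _) _) (fun k => ?_) hYs
    rw [D1]; simp only [hY]
    have h1 : 0 ≤ (max (b k) 0) ^ r := by positivity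
    have h2 : 0 ≤ |a k - 1| ^ r := by positivity
    linarith
  have ds : Summable fun k => D k ^ r := (summable_nat_add_iff 1).1 ds1
  have edd := jac_shift ds (by rw [D0, Real.zero_rpow (by linarith)])
  have hXsum : HasSum X (3 ^ (r-1) * ∑' k, Y k) := by
    have h1 := ((hYs.hasSum.sub ds1.hasSum).add ds.hasSum).mul_left ((3:ℝ) ^ (r-1))
    rw [edd, sub_add_cancel] at h1
    refine h1.congr_fun ?_ |> id
    intro k
    simp only [hX, hY, D1]; ring
  have main : ∀ S, 3 ^ (r-1) * ∑' k, Y k < S → (L - 2) ^ p ≤ G * S := by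
    intro S hS
    have hS0 : 0 < S := lt_of_le_of_lt (mul_nonneg (by positivity) (tsum_nonneg hY0)) hS
    refine jac_core p hp (L-2) (∑' k, V k ^ 2) (∑' k, (V (k+1) - V k) ^ 2) S G (by linarith) Q0
      hS0 hG hG1 ?_
    intro τ ε hτ hε
    rw [← hr]
    have hκ : 0 ≤ τ / τ ^ r / r := by positivity
    have hM : ∀ k, V k ^ 2 ≤ ((∑' k, (V (k+1) - V k) ^ 2) / ε + ε * ∑' k, V k ^ 2) / 2 := by
      intro k
      linarith [jac_sup V V0 Vs Vd ε hε k]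
    have := jac_energy V D (fun k => max (b k) 0 + D k + D (k+1)) X V0 Vn Vs Vd D0 Dn B hB L
      _ ((1 - 1/r) * τ) (τ / τ ^ r / r) X0 hXsum.summable hκ hM ?_ ?_
    · refine this.trans ?_
      rw [hXsum.tsum_eq]
      have hM0 := (sq_nonneg _).trans (hM 0)
      gcongr
    · intro k
      have hb0 : 0 ≤ max (b k) 0 := le_max_right _ _
      refine (jac_young r τ _ hr1 hτ (add_nonneg (add_nonneg hb0 (Dn k)) (Dn (k+1)))).trans ?_
      have := jac_three r _ _ _ hr1 hb0 (Dn k) (Dn (k+1))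
      simp only [hX]
      gcongr
    · intro k
      have h1 := hv k
      have h2 : b k * v k ≤ max (b k) 0 * v k :=
        mul_le_mul_of_nonneg_right (le_max_left _ _) (hv0 k)
      have h3 : a k * v (k+1) ≤ (1 + |a k - 1|) * v (k+1) :=
        mul_le_mul_of_nonneg_right (by linarith [le_abs_self (a k - 1)]) (hv0 _)
      have h4 : (if k = 0 then 0 else a (k-1) * v (k-1)) ≤ (1 + D k) * V k := by
        cases k with
        | zero => simp [V0]
        | succ k =>
          simp only [V1, D1, Nat.add_sub_cancel]
          rw [if_neg (by omega)]
          exact mul_le_mul_of_nonneg_right (by linarith [le_abs_self (a k - 1)]) (hv0 _)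
      have V2 : V (k+2) = v (k+1) := V1 (k+1)
      rw [V1, V2, D1]
      linarith
  rw [hcp, show p - 1/2 = r - 1 by rw [hr]; ring]
  by_contra! hcon
  have h5 : 3 ^ (r-1) * ∑' k, Y k < (L-2) ^ p / G := by
    rw [lt_div_iff₀ hG]; linarith
  obtain ⟨S, hS1, hS2⟩ := exists_between h5
  rw [lt_div_iff₀ hG] at hS2
  linarith [main S hS1]

theorem single_eigenvalue_selfadjoint_small_coupling
    (a b : ℕ → ℝ) (hapos : ∀ k, 0 < a k)
    (ha : Filter.Tendsto a Filter.atTop (nhds 1))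
    (hb : Filter.Tendsto b Filter.atTop (nhds 0))
    (J : l2 →L[ℂ] l2)
    (hJ : IsJacobi J (fun k => ((a k : ℝ) : ℂ)) (fun k => ((b k : ℝ) : ℂ)))
    (p : ℝ) (hp : 1 ≤ p)
    (lam : ℝ) (hlam : HasEigen J ((lam : ℝ) : ℂ)) :
    (ENNReal.ofReal ((max (lam - 2) 0) ^ p)
      ≤ ENNReal.ofReal (cp p) *
        ∑' k : ℕ, (ENNReal.ofReal ((max (b k) 0) ^ (p + 1/2))
          + 2 * ENNReal.ofReal (|a k - 1| ^ (p + 1/2))))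
    ∧ (ENNReal.ofReal ((max (-(lam + 2)) 0) ^ p)
      ≤ ENNReal.ofReal (cp p) *
        ∑' k : ℕ, (ENNReal.ofReal ((max (-(b k)) 0) ^ (p + 1/2))
          + 2 * ENNReal.ofReal (|a k - 1| ^ (p + 1/2)))) := by
  obtain ⟨u, hu0, hu⟩ := hlam
  have hus : Summable fun k => ‖(u : ∀ _ : ℕ, ℂ) k‖ ^ 2 := by
    have := (lp.memℓp u).summable (by norm_num)
    simpa using this
  have hune : ∃ k, ‖(u : ∀ _ : ℕ, ℂ) k‖ ≠ 0 := by
    by_contra! h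
    apply hu0
    ext k
    simpa using h k
  have key : ∀ k, |lam - b k| * ‖(u : ∀ _ : ℕ, ℂ) k‖ ≤
      (if k = 0 then 0 else a (k-1) * ‖(u : ∀ _ : ℕ, ℂ) (k-1)‖)
      + a k * ‖(u : ∀ _ : ℕ, ℂ) (k+1)‖ := by
    intro k
    have h1 := hJ u k
    rw [hu] at h1
    have h2 : (((lam - b k : ℝ)) : ℂ) * (u : ∀ _ : ℕ, ℂ) k =
        (if k = 0 then 0 else ((a (k-1) : ℝ) : ℂ) * (u : ∀ _ : ℕ, ℂ) (k-1))
        + ((a k : ℝ) : ℂ) * (u : ∀ _ : ℕ, ℂ) (k+1) := by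
      have h3 : ((lam : ℂ) • u : l2) k = (lam : ℂ) * (u : ∀ _ : ℕ, ℂ) k := rfl
      rw [h3] at h1
      push_cast
      linear_combination h1
    have h4 := congrArg norm h2
    rw [norm_mul, Complex.norm_real, Real.norm_eq_abs] at h4
    rw [h4]
    refine (norm_add_le _ _).trans (add_le_add ?_ ?_)
    · split_ifs
      · simp
      · rw [norm_mul, Complex.norm_real, Real.norm_eq_abs, abs_of_pos (hapos _)]
    · rw [norm_mul, Complex.norm_real, Real.norm_eq_abs, abs_of_pos (hapos _)]
  constructor
  · refine jac_half a b (fun k => ‖(u : ∀ _ : ℕ, ℂ) k‖) ha (fun k => norm_nonneg _) hus hune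
      lam p hp fun k => ?_
    have h1 := mul_le_mul_of_nonneg_right (le_abs_self (lam - b k))
      (norm_nonneg ((u : ∀ _ : ℕ, ℂ) k))
    linarith [key k]
  · rw [show -(lam + 2) = -lam - 2 by ring]
    refine jac_half a (fun k => -b k) (fun k => ‖(u : ∀ _ : ℕ, ℂ) k‖) ha
      (fun k => norm_nonneg _) hus hune (-lam) p hp fun k => ?_
    have h1 := mul_le_mul_of_nonneg_right (neg_le_abs (lam - b k))
      (norm_nonneg ((u : ∀ _ : ℕ, ℂ) k))
    linarith [key k]
end
end

section
/- Let p ≥ 1, let J = J({a_k},{b_k}) be a complex Jacobi matrix, and let λ(J) be an eigenvalue of J. Then for each choice of sign ±, (Re λ(J) ∓ 2)_±^p ≤ c_p · Σ_{k=1}^∞ ( (Re b_k)_±^{p+1/2} + 2|Re a_k − 1|^{p+1/2} ) and (Re λ(J) ∓ 2)_±^p ≤ 3^{p−1} · Σ_{k=1}^∞ ( (Re b_k)_±^p + 2|Re a_k − 1|^p ). -/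
/- Golinskii–Kupin, Theorem 6, inequalities (21): for a complex Jacobi matrix J
   and any eigenvalue λ(J), for each sign ±,
   (Re λ(J) ∓ 2)_±^p ≤ c_p Σ_k ((Re b_k)_±^{p+1/2} + 2|Re a_k − 1|^{p+1/2})  and
   (Re λ(J) ∓ 2)_±^p ≤ 3^{p−1} Σ_k ((Re b_k)_±^p + 2|Re a_k − 1|^p). -/

open scoped ENNReal

noncomputable section

open MeasureTheory in
lemma beta_lint (α β w : ℝ) (hα : 0 < α) (hβ : 0 < β) (hab : 0 < α + β - 1) (hw : 0 ≤ w) :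
    ∫⁻ t : ℝ, ENNReal.ofReal (if 0 < t ∧ t < w then t ^ (α - 1) * (w - t) ^ (β - 1) else 0)
      = ENNReal.ofReal (w ^ (α + β - 1) * ProbabilityTheory.beta α β) := by
  rcases hw.eq_or_lt with rfl | hw
  · have : ∀ t : ℝ, ¬ (0 < t ∧ t < 0) := fun t h => by linarith [h.1, h.2]
    simp [this, Real.zero_rpow hab.ne']
  have hB := ProbabilityTheory.beta_pos hα hβ
  have h1 : ∀ t : ℝ, ENNReal.ofReal (if 0 < t ∧ t < w then t ^ (α - 1) * (w - t) ^ (β - 1) else 0)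
      = ENNReal.ofReal (ProbabilityTheory.beta α β * w ^ (α + β - 2)) *
        ProbabilityTheory.betaPDF α β (w⁻¹ * t) := by
    intro t
    rw [ProbabilityTheory.betaPDF_eq, ← ENNReal.ofReal_mul (by positivity)]
    congr 1
    have e : (0 < w⁻¹ * t ∧ w⁻¹ * t < 1) ↔ (0 < t ∧ t < w) := by
      rw [inv_mul_lt_iff₀ hw, mul_one]
      constructor
      · rintro ⟨h, h'⟩
        exact ⟨by simpa [hw] using h, h'⟩
      · rintro ⟨h, h'⟩
        exact ⟨by positivity, h'⟩
    simp only [e]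
    split_ifs with h
    · obtain ⟨h0, h1⟩ := h
      have e1 : 1 - w⁻¹ * t = w⁻¹ * (w - t) := by field_simp
      rw [e1, Real.mul_rpow (by positivity) h0.le, Real.mul_rpow (by positivity) (by linarith),
        Real.inv_rpow hw.le, Real.inv_rpow hw.le,
        show α + β - 2 = (α - 1) + (β - 1) by ring, Real.rpow_add hw]
      have := Real.rpow_pos_of_pos hw (α-1)
      have := Real.rpow_pos_of_pos hw (β-1)
      field_simp
    · simp
  have hm : Measurable (ProbabilityTheory.betaPDF α β) :=
    (ProbabilityTheory.measurable_betaPDFReal α β).ennreal_ofReal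
  have h2 : ∫⁻ t : ℝ, ProbabilityTheory.betaPDF α β (w⁻¹ * t) = ENNReal.ofReal w := by
    rw [← lintegral_map (f := ProbabilityTheory.betaPDF α β) (g := fun t => w⁻¹ * t) hm
      (by fun_prop), Real.map_volume_mul_left (by positivity), lintegral_smul_measure,
      ProbabilityTheory.lintegral_betaPDF_eq_one hα hβ]
    simp [abs_of_pos hw]
  simp_rw [h1]
  have hm2 : Measurable fun t : ℝ => ProbabilityTheory.betaPDF α β (w⁻¹ * t) :=
    hm.comp (by fun_prop)
  rw [lintegral_const_mul _ hm2, h2, ← ENNReal.ofReal_mul (by positivity)]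
  congr 1
  rw [show α + β - 1 = (α + β - 2) + 1 by ring, Real.rpow_add_one hw.ne']
  ring

/-- Aizenman–Lieb integration. -/
lemma al_step (p e : ℝ) (hp : 1 ≤ p) (he : 0 ≤ e) (V : ℕ → ℝ) (hV : ∀ k, 0 ≤ V k)
    (h : ∀ t : ℝ, 0 < t → t < e → Summable (fun k => max (V k - t) 0) →
      e - t ≤ (∑' k, max (V k - t) 0) ^ 2 / 4) :
    ENNReal.ofReal (e ^ p) ≤ ENNReal.ofReal ((1/2) * (Real.Gamma (p+1) / Real.Gamma (p+3/2)) *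
      (Real.Gamma 2 / Real.Gamma (3/2))) * ∑' k, ENNReal.ofReal (V k ^ (p + 1/2)) := by
  have hpt : ∀ t : ℝ, ENNReal.ofReal
      (if 0 < t ∧ t < e then t ^ ((p - 1/2) - 1) * (e - t) ^ ((3/2 : ℝ) - 1) else 0) ≤
      ENNReal.ofReal (1/2) * ∑' k, ENNReal.ofReal
        (if 0 < t ∧ t < V k then t ^ ((p - 1/2) - 1) * (V k - t) ^ ((2 : ℝ) - 1) else 0) := by
    intro t
    split_ifs with ht
    swap
    · simp
    obtain ⟨h0, h1⟩ := ht
    have hc : 0 ≤ t ^ ((p - 1/2) - 1) := by positivity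
    have e1 : ∀ k, (if 0 < t ∧ t < V k then t ^ ((p - 1/2) - 1) * (V k - t) ^ ((2 : ℝ) - 1) else 0)
        = t ^ ((p - 1/2) - 1) * max (V k - t) 0 := by
      intro k
      rw [show (2:ℝ) - 1 = 1 by norm_num, Real.rpow_one]
      split_ifs with hk
      · rw [max_eq_left (by linarith [hk.2])]
      · rw [max_eq_right (by by_contra hh; exact hk ⟨h0, by linarith⟩)]
        simp
    simp_rw [e1, ENNReal.ofReal_mul hc]
    rw [ENNReal.tsum_mul_left, ← mul_assoc, mul_comm (ENNReal.ofReal (1/2)), mul_assoc]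
    gcongr
    by_cases hs : Summable (fun k => max (V k - t) 0)
    · have := h t h0 h1 hs
      have hS : 0 ≤ ∑' k, max (V k - t) 0 := tsum_nonneg fun k => le_max_right _ _
      rw [← ENNReal.ofReal_tsum_of_nonneg (fun k => le_max_right _ _) hs,
        ← ENNReal.ofReal_mul (by norm_num)]
      apply ENNReal.ofReal_le_ofReal
      rw [show (3/2:ℝ) - 1 = 1/2 by norm_num, ← Real.sqrt_eq_rpow]
      apply Real.sqrt_le_iff.2
      constructor
      · positivity
      · nlinarith
    · have : ∑' k, ENNReal.ofReal (max (V k - t) 0) = ∞ := by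
        by_contra hh
        apply hs
        have := ENNReal.summable_toReal hh
        refine this.congr fun k => ?_
        rw [ENNReal.toReal_ofReal (le_max_right _ _)]
      rw [this, ENNReal.mul_top (by simp)]
      exact le_top
  have hInt := MeasureTheory.lintegral_mono (μ := MeasureTheory.volume) hpt
  have hmeas : ∀ k, Measurable fun t : ℝ => ENNReal.ofReal
        (if 0 < t ∧ t < V k then t ^ ((p - 1/2) - 1) * (V k - t) ^ ((2 : ℝ) - 1) else 0) := by
    intro k
    refine Measurable.ennreal_ofReal (Measurable.ite measurableSet_Ioo (by fun_prop) (by fun_prop))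
  rw [beta_lint _ _ _ (by linarith) (by norm_num) (by linarith) he,
    MeasureTheory.lintegral_const_mul _ (Measurable.tsum hmeas),
    MeasureTheory.lintegral_tsum (fun k => (hmeas k).aemeasurable)] at hInt
  have e2 : ∀ k, ∫⁻ t : ℝ, ENNReal.ofReal
        (if 0 < t ∧ t < V k then t ^ ((p - 1/2) - 1) * (V k - t) ^ ((2 : ℝ) - 1) else 0)
      = ENNReal.ofReal (V k ^ (p + 1/2)) * ENNReal.ofReal (ProbabilityTheory.beta (p-1/2) 2) := by
    intro k
    rw [beta_lint _ _ _ (by linarith) (by norm_num) (by linarith) (hV k),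
      ENNReal.ofReal_mul (Real.rpow_nonneg (hV k) _)]
    congr 3
    ring
  simp_rw [e2] at hInt
  rw [ENNReal.tsum_mul_right, show p - 1/2 + 3/2 - 1 = p by ring] at hInt
  have hB := ProbabilityTheory.beta_pos (α := p - 1/2) (β := 3/2) (by linarith) (by norm_num)
  have hB2 := ProbabilityTheory.beta_pos (α := p - 1/2) (β := 2) (by linarith) (by norm_num)
  have e3 : e ^ p = (ProbabilityTheory.beta (p-1/2) (3/2))⁻¹ *
      (e ^ p * ProbabilityTheory.beta (p-1/2) (3/2)) := by
    rw [mul_comm, mul_assoc, mul_inv_cancel₀ hB.ne', mul_one]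
  rw [e3, ENNReal.ofReal_mul (by positivity)]
  refine (mul_le_mul_right hInt _).trans (le_of_eq ?_)
  rw [mul_comm (∑' k, ENNReal.ofReal (V k ^ (p + 1/2))), ← mul_assoc, ← mul_assoc,
    ← ENNReal.ofReal_mul (by positivity), ← ENNReal.ofReal_mul (by positivity)]
  congr 2
  unfold ProbabilityTheory.beta
  rw [show p - 1/2 + 3/2 = p + 1 by ring, show p - 1/2 + 2 = p + 3/2 by ring]
  have := Real.Gamma_pos_of_pos (show 0 < p - 1/2 by linarith)
  have := Real.Gamma_pos_of_pos (show 0 < p + 1 by linarith)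
  have := Real.Gamma_pos_of_pos (show 0 < p + 3/2 by linarith)
  have := Real.Gamma_pos_of_pos (show (0:ℝ) < 3/2 by norm_num)
  generalize Real.Gamma (p - 1/2) = g1 at *
  generalize Real.Gamma (p + 1) = g2 at *
  generalize Real.Gamma (p + 3/2) = g3 at *
  generalize Real.Gamma (3/2) = g4 at *
  field_simp

lemma rpow3 (x y z q : ℝ) (hx : 0 ≤ x) (hy : 0 ≤ y) (hz : 0 ≤ z) (hq : 1 ≤ q) :
    (x + y + z) ^ q ≤ 3 ^ (q - 1) * (x ^ q + y ^ q + z ^ q) := by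
  have := Real.rpow_sum_le_const_mul_sum_rpow_of_nonneg (s := Finset.univ)
    (f := ![x, y, z]) (p := q) hq (by intro i _; fin_cases i <;> simpa)
  simpa [Fin.sum_univ_three] using this

def Vpot (B A : ℕ → ℝ) (k : ℕ) : ℝ := B k + A k + (if k = 0 then 0 else A (k - 1))

lemma V_sum (B A : ℕ → ℝ) (hB : ∀ k, 0 ≤ B k) (hA : ∀ k, 0 ≤ A k) (q : ℝ) (hq : 1 ≤ q) :
    ∑' k, ENNReal.ofReal (Vpot B A k ^ q) ≤ ENNReal.ofReal (3 ^ (q - 1)) *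
      ∑' k, (ENNReal.ofReal (B k ^ q) + 2 * ENNReal.ofReal (A k ^ q)) := by
  have h1 : ∀ k, ENNReal.ofReal (Vpot B A k ^ q) ≤ ENNReal.ofReal (3 ^ (q - 1)) *
      (ENNReal.ofReal (B k ^ q) + ENNReal.ofReal (A k ^ q) +
        (if k = 0 then 0 else ENNReal.ofReal (A (k - 1) ^ q))) := by
    intro k
    have hk : 0 ≤ (if k = 0 then 0 else A (k - 1)) := by
      split_ifs
      · exact le_rfl
      · exact hA _
    have := rpow3 _ _ _ q (hB k) (hA k) hk hq
    refine (ENNReal.ofReal_le_ofReal this).trans (le_of_eq ?_)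
    have b1 := Real.rpow_nonneg (hB k) q
    have b2 := Real.rpow_nonneg (hA k) q
    have b3 := Real.rpow_nonneg hk q
    rw [ENNReal.ofReal_mul (by positivity), ENNReal.ofReal_add (by positivity) b3,
      ENNReal.ofReal_add b1 b2]
    split_ifs with h0
    · simp [Real.zero_rpow (by linarith : q ≠ 0)]
    · rfl
  refine (ENNReal.tsum_le_tsum h1).trans (le_of_eq ?_)
  rw [ENNReal.tsum_mul_left, ENNReal.tsum_add, ENNReal.tsum_add, ENNReal.tsum_add,
    ENNReal.tsum_mul_left]
  congr 1
  rw [tsum_eq_zero_add' (f := fun k => if k = 0 then 0 else ENNReal.ofReal (A (k - 1) ^ q))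
    ENNReal.summable]
  simp
  rw [add_assoc, two_mul]

/-- sup bound -/
lemma sup_bound (x : ℕ → ℝ) (hx : HasSum (fun k => x k ^ 2) 1)
    (hd : Summable fun k => (x (k+1) - x k) ^ 2) (n : ℕ) (δ : ℝ) (hδ : 0 < δ) :
    x n ^ 2 ≤ δ * (x 0 ^ 2 + ∑' k, (x (k+1) - x k) ^ 2) / 4 + 1 / δ := by
  have hpt : ∀ s t : ℝ, |s ^ 2 - t ^ 2| ≤ δ / 2 * (s - t) ^ 2 + (s ^ 2 + t ^ 2) / δ := by
    intro s t
    have h1 : (s ^ 2 + t ^ 2) / δ = (s-t)^2/(2*δ) + (s + t) ^ 2 / (2 * δ) := by field_simp; ring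
    have h2 : 0 ≤ (s-t)^2/(2*δ) := by positivity
    have h3 : δ / 2 * (s - t) ^ 2 + (s + t) ^ 2 / (2 * δ) - |s-t| * |s+t|
        = (δ * |s-t| - |s+t|) ^ 2 / (2 * δ) := by
      rw [← sq_abs (s - t), ← sq_abs (s+t)]; field_simp; ring
    have h4 : 0 ≤ (δ * |s-t| - |s+t|) ^ 2 / (2 * δ) := by positivity
    have h5 : |s ^ 2 - t ^ 2| = |s-t| * |s+t| := by rw [← abs_mul]; congr 1; ring
    linarith
  -- finite estimate
  have hfin : ∀ m, 2 * x n ^ 2 - x (n + m) ^ 2 ≤ x 0 ^ 2 +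
      ∑ k ∈ Finset.range (n + m), |x (k+1) ^ 2 - x k ^ 2| := by
    intro m
    rw [Finset.sum_range_add]
    have a1 : x n ^ 2 - x 0 ^ 2 ≤ ∑ k ∈ Finset.range n, |x (k+1) ^ 2 - x k ^ 2| := by
      rw [← Finset.sum_range_sub (fun k => x k ^ 2)]
      exact Finset.sum_le_sum fun k _ => le_abs_self _
    have a2 : x n ^ 2 - x (n+m) ^ 2 ≤
        ∑ k ∈ Finset.range m, |x (n+k+1) ^ 2 - x (n+k) ^ 2| := by
      have := Finset.sum_range_sub' (fun k => x (n+k) ^ 2) m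
      simp only [add_zero] at this
      rw [← this]
      refine Finset.sum_le_sum fun k _ => ?_
      rw [abs_sub_comm]
      exact le_abs_self _
    linarith
  have hx' : HasSum (fun k => x (k+1) ^ 2) (1 - x 0 ^ 2) := by
    have := (hasSum_nat_add_iff' (f := fun k => x k ^ 2) (g := 1) 1).2 hx
    simpa using this
  have hsumm : HasSum (fun k => δ / 2 * (x (k+1) - x k) ^ 2 + (x (k+1) ^ 2 + x k ^ 2) / δ)
      (δ / 2 * (∑' k, (x (k+1) - x k) ^ 2) + ((1 - x 0 ^ 2) + 1) / δ) :=
    (hd.hasSum.mul_left _).add ((hx'.add hx).div_const _)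
  have hb : ∀ m, 2 * x n ^ 2 - x (n + m) ^ 2 ≤ x 0 ^ 2 +
      (δ / 2 * (∑' k, (x (k+1) - x k) ^ 2) + ((1 - x 0 ^ 2) + 1) / δ) := by
    intro m
    refine (hfin m).trans ?_
    gcongr
    refine (Finset.sum_le_sum fun k _ => hpt (x (k+1)) (x k)).trans ?_
    exact sum_le_hasSum _ (fun k _ => by positivity) hsumm
  have hlim : Filter.Tendsto (fun m => 2 * x n ^ 2 - x (n + m) ^ 2) Filter.atTop
      (nhds (2 * x n ^ 2 - 0)) := by
    refine Filter.Tendsto.sub tendsto_const_nhds ?_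
    have := hx.summable.tendsto_atTop_zero
    exact this.comp (Filter.tendsto_atTop_mono (fun m => Nat.le_add_left m n) Filter.tendsto_id)
  have hfinal := le_of_tendsto' hlim hb
  have h0 := hpt (x 0) 0
  rw [sub_zero, zero_pow two_ne_zero, sub_zero, abs_of_nonneg (sq_nonneg _), add_zero] at h0
  have e1 : ((1 - x 0 ^ 2) + 1) / δ = 2 * (1 / δ) - x 0 ^ 2 / δ := by ring
  linarith

lemma half_bound (x V : ℕ → ℝ) (hx : HasSum (fun k => x k ^ 2) 1)
    (hd : Summable fun k => (x (k+1) - x k) ^ 2) (hVx : Summable fun k => V k * x k ^ 2) (e : ℝ)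
    (he : e ≤ ∑' k, V k * x k ^ 2 - (x 0 ^ 2 + ∑' k, (x (k+1) - x k) ^ 2))
    (t : ℝ) (hs : Summable (fun k => max (V k - t) 0)) :
    e - t ≤ (∑' k, max (V k - t) 0) ^ 2 / 4 := by
  set D := x 0 ^ 2 + ∑' k, (x (k+1) - x k) ^ 2 with hD
  set S := ∑' k, max (V k - t) 0 with hS
  have hD0 : 0 ≤ D := add_nonneg (sq_nonneg _) (tsum_nonneg fun k => sq_nonneg _)
  have hS0 : 0 ≤ S := tsum_nonneg fun k => le_max_right _ _
  have h1 : HasSum (fun k => V k * x k ^ 2 - t * x k ^ 2) (∑' k, V k * x k ^ 2 - t * 1) :=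
    hVx.hasSum.sub (hx.mul_left t)
  have key : ∀ c : ℝ, (∀ n, x n ^ 2 ≤ c) → ∑' k, V k * x k ^ 2 - t * 1 ≤ S * c := by
    intro c hc
    refine hasSum_le (fun k => ?_) h1 (hs.hasSum.mul_right c)
    calc V k * x k ^ 2 - t * x k ^ 2 = (V k - t) * x k ^ 2 := by ring
      _ ≤ max (V k - t) 0 * x k ^ 2 := by gcongr; exact le_max_left _ _
      _ ≤ max (V k - t) 0 * c := mul_le_mul_of_nonneg_left (hc k) (le_max_right _ _)
  rcases hS0.eq_or_lt with h0 | h0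
  · have := key 1 (fun n => le_hasSum hx n (fun k _ => sq_nonneg _))
    rw [← h0] at this ⊢
    linarith
  · have := key _ (fun n => sup_bound x hx hd n (4 / S) (by positivity))
    rw [← hD] at this
    have e2 : S * (4 / S * D / 4 + 1 / (4 / S)) = D + S ^ 2 / 4 := by field_simp
    rw [e2] at this
    linarith

lemma exists_ge (x V : ℕ → ℝ) (hx : HasSum (fun k => x k ^ 2) 1)
    (hVx : Summable fun k => V k * x k ^ 2) (e : ℝ)
    (he : e ≤ ∑' k, V k * x k ^ 2) : ∃ k, e ≤ V k := by
  by_contra! hh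
  obtain ⟨i, hi⟩ : ∃ i, x i ≠ 0 := by
    by_contra! h0
    have : (fun k => x k ^ 2) = fun _ => 0 := by ext k; simp [h0 k]
    rw [this] at hx
    exact zero_ne_one (hasSum_zero.unique hx)
  have := hasSum_lt (f := fun k => V k * x k ^ 2) (g := fun k => e * x k ^ 2) (i := i)
    (fun k => by have := hh k; dsimp; gcongr) 
    (by have := hh i; have : 0 < x i ^ 2 := by positivity
        gcongr) hVx.hasSum (hx.mul_left e)
  linarith

lemma hasSum_shift (f : ℕ → ℝ) (s : ℝ) (h : HasSum f s) :
    HasSum (fun k => if k = 0 then 0 else f (k - 1)) s := by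
  have := (hasSum_nat_add_iff (f := fun k => if k = 0 then 0 else f (k - 1)) (g := s) 1).1
    (by simpa using h)
  simpa using this

lemma core (u a b : ℕ → ℂ) (lam : ℂ) (M : ℝ) (ha : ∀ k, ‖a k‖ ≤ M) (hb : ∀ k, ‖b k‖ ≤ M)
    (hu : HasSum (fun k => ‖u k‖ ^ 2) 1)
    (heq : ∀ k, lam * u k = (if k = 0 then 0 else a (k - 1) * u (k - 1)) + b k * u k
      + a k * u (k + 1)) :
    (Summable fun k => (‖u (k+1)‖ - ‖u k‖) ^ 2) ∧
    (Summable fun k => Vpot (fun k => max (b k).re 0) (fun k => |(a k).re - 1|) k * ‖u k‖ ^ 2) ∧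
    lam.re - 2 ≤ ∑' k, Vpot (fun k => max (b k).re 0) (fun k => |(a k).re - 1|) k * ‖u k‖ ^ 2
      - (‖u 0‖ ^ 2 + ∑' k, (‖u (k+1)‖ - ‖u k‖) ^ 2) := by
  have hM : 0 ≤ M := (norm_nonneg _).trans (ha 0)
  set x : ℕ → ℝ := fun k => ‖u k‖ with hxdef
  have hx0 : ∀ k, 0 ≤ x k := fun k => norm_nonneg _
  set B : ℕ → ℝ := fun k => max (b k).re 0 with hB
  set A : ℕ → ℝ := fun k => |(a k).re - 1| with hA
  have hx : HasSum (fun k => x k ^ 2) 1 := hu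
  have hx' : HasSum (fun k => x (k+1) ^ 2) (1 - x 0 ^ 2) := by
    have := (hasSum_nat_add_iff' (f := fun k => x k ^ 2) (g := 1) 1).2 hx
    simpa using this
  have hxx : Summable fun k => x k ^ 2 + x (k+1) ^ 2 := hx.summable.add hx'.summable
  have bdd : ∀ (f : ℕ → ℝ) (C : ℝ), (∀ k, |f k| ≤ C * (x k ^ 2 + x (k+1) ^ 2)) → Summable f :=
    fun f C h => Summable.of_norm_bounded (hxx.mul_left C) h
  have hA0 : ∀ k, 0 ≤ A k := fun k => abs_nonneg _
  have hB0 : ∀ k, 0 ≤ B k := fun k => le_max_right _ _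
  have hAM : ∀ k, A k ≤ M + 1 := by
    intro k
    have h1 := abs_sub (a k).re 1
    have h2 := Complex.abs_re_le_norm (a k)
    have := ha k
    simp only [abs_one] at h1
    simp only [hA]
    linarith
  have hBM : ∀ k, B k ≤ M := by
    intro k
    have h2 := (le_abs_self _).trans (Complex.abs_re_le_norm (b k))
    exact max_le (h2.trans (hb k)) hM
  have hdiff : Summable fun k => (x (k+1) - x k) ^ 2 := by
    refine bdd _ 2 fun k => ?_
    rw [abs_of_nonneg (sq_nonneg _)]
    nlinarith [sq_nonneg (x (k+1) + x k)]
  have hBx : Summable fun k => B k * x k ^ 2 := by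
    refine bdd _ M fun k => ?_
    rw [abs_of_nonneg (mul_nonneg (hB0 k) (sq_nonneg _))]
    have := hBM k
    gcongr
    linarith [sq_nonneg (x (k+1))]
  have hbx : Summable fun k => (b k).re * x k ^ 2 := by
    refine bdd _ M fun k => ?_
    rw [abs_mul, abs_of_nonneg (sq_nonneg (x k))]
    have := (Complex.abs_re_le_norm (b k)).trans (hb k)
    gcongr
    linarith [sq_nonneg (x (k+1))]
  have hAx : Summable fun k => A k * x k ^ 2 := by
    refine bdd _ (M+1) fun k => ?_
    rw [abs_of_nonneg (mul_nonneg (hA0 k) (sq_nonneg _))]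
    have := hAM k
    gcongr
    linarith [sq_nonneg (x (k+1))]
  have hAx' : Summable fun k => A k * x (k+1) ^ 2 := by
    refine bdd _ (M+1) fun k => ?_
    rw [abs_of_nonneg (mul_nonneg (hA0 k) (sq_nonneg _))]
    have := hAM k
    gcongr
    linarith [sq_nonneg (x k)]
  have hV : HasSum (fun k => Vpot B A k * x k ^ 2)
      (∑' k, B k * x k ^ 2 + ∑' k, A k * x k ^ 2 + ∑' k, A k * x (k+1) ^ 2) := by
    have := (hBx.hasSum.add hAx.hasSum).add (hasSum_shift _ _ hAx'.hasSum)
    refine this.congr_fun ?_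
    intro k
    unfold Vpot
    rcases k with _ | k
    · simp; ring
    · simp; ring
  refine ⟨hdiff, hV.summable, ?_⟩
  rw [hV.tsum_eq]
  set c : ℕ → ℝ := fun k => (a k * u (k+1) * (starRingEnd ℂ) (u k)).re with hc
  set d : ℕ → ℝ := fun k => (a k * u k * (starRingEnd ℂ) (u (k+1))).re with hd
  have hxy : ∀ k, x k * x (k+1) ≤ x k ^ 2 + x (k+1) ^ 2 := fun k => by
    nlinarith [sq_nonneg (x k - x (k+1)), sq_nonneg (x k), sq_nonneg (x (k+1))]
  have hcs : Summable c := by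
    refine bdd _ M fun k => (Complex.abs_re_le_norm _).trans ?_
    rw [norm_mul, norm_mul, RCLike.norm_conj, mul_assoc, mul_comm ‖u (k+1)‖]
    exact mul_le_mul (ha k) (hxy k) (by positivity) hM
  have hds : Summable d := by
    refine bdd _ M fun k => (Complex.abs_re_le_norm _).trans ?_
    rw [norm_mul, norm_mul, RCLike.norm_conj, mul_assoc]
    exact mul_le_mul (ha k) (hxy k) (by positivity) hM
  have hxk : ∀ k, x k ^ 2 = (u k).re ^ 2 + (u k).im ^ 2 := fun k => by
    simp only [hxdef]; rw [Complex.sq_norm, Complex.normSq_apply]; ring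
  have hpt : ∀ k, lam.re * x k ^ 2 = (if k = 0 then 0 else d (k - 1)) + (b k).re * x k ^ 2 + c k := by
    intro k
    have h1 := congrArg (fun z => (z * (starRingEnd ℂ) (u k)).re) (heq k)
    simp only [hxk]
    rcases k with _ | k
    · simp [hc] at h1 ⊢
      linarith
    · simp [hc, hd] at h1 ⊢
      linarith
  have hl : lam.re = ∑' k, d k + ∑' k, (b k).re * x k ^ 2 + ∑' k, c k := by
    have h1 := ((hasSum_shift _ _ hds.hasSum).add hbx.hasSum).add hcs.hasSum
    have h2 := hx.mul_left lam.re
    rw [mul_one] at h2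
    refine h2.unique ?_
    simpa only [hpt] using h1
  have hle := hasSum_le (f := fun k => d k + (b k).re * x k ^ 2 + c k)
    (g := fun k => B k * x k ^ 2 + A k * x k ^ 2 + A k * x (k+1) ^ 2 + (x k ^ 2 + x (k+1) ^ 2)
      - (x (k+1) - x k) ^ 2) ?_ ((hds.hasSum.add hbx.hasSum).add hcs.hasSum)
    ((((hBx.hasSum.add hAx.hasSum).add hAx'.hasSum).add (hx.add hx')).sub hdiff.hasSum)
  · rw [← hl] at hle
    simp only [hxdef] at hle ⊢
    linarith
  · intro k
    have h1 : (b k).re * x k ^ 2 ≤ B k * x k ^ 2 := by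
      gcongr
      exact le_max_left _ _
    set r := (u k * (starRingEnd ℂ) (u (k+1))).re with hr
    have h2 : c k + d k = 2 * (a k).re * r := by
      simp [hc, hd, hr]; ring
    have h3 : |r| ≤ x k * x (k+1) := by
      refine (Complex.abs_re_le_norm _).trans ?_
      rw [norm_mul, RCLike.norm_conj]
    have h4 : (a k).re * r ≤ A k * (x k * x (k+1)) + x k * x (k+1) := by
      have e1 : (a k).re * r = ((a k).re - 1) * r + r := by ring
      have e2 : ((a k).re - 1) * r ≤ A k * (x k * x (k+1)) := by
        refine (le_abs_self _).trans ?_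
        rw [abs_mul]
        exact mul_le_mul_of_nonneg_left h3 (abs_nonneg _)
      linarith [le_abs_self r]
    have h5 : A k * (2 * (x k * x (k+1))) ≤ A k * (x k ^ 2 + x (k+1) ^ 2) := by
      refine mul_le_mul_of_nonneg_left ?_ (hA0 k)
      nlinarith [sq_nonneg (x k - x (k+1))]
    linarith

lemma cp_eq (p : ℝ) : cp p = ((1/2) * (Real.Gamma (p+1) / Real.Gamma (p+3/2)) *
    (Real.Gamma 2 / Real.Gamma (3/2))) * 3 ^ (p - 1/2) := by
  unfold cp; ring

/-- The two upper bounds for a normalized eigenvector. -/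
lemma plus_case (u a b : ℕ → ℂ) (lam : ℂ) (M : ℝ) (ha : ∀ k, ‖a k‖ ≤ M) (hb : ∀ k, ‖b k‖ ≤ M)
    (hu : HasSum (fun k => ‖u k‖ ^ 2) 1)
    (heq : ∀ k, lam * u k = (if k = 0 then 0 else a (k - 1) * u (k - 1)) + b k * u k
      + a k * u (k + 1)) (p : ℝ) (hp : 1 ≤ p) :
    (ENNReal.ofReal ((max (lam.re - 2) 0) ^ p)
      ≤ ENNReal.ofReal (cp p) *
        ∑' k : ℕ, (ENNReal.ofReal ((max (b k).re 0) ^ (p + 1/2))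
          + 2 * ENNReal.ofReal (|(a k).re - 1| ^ (p + 1/2))))
    ∧ (ENNReal.ofReal ((max (lam.re - 2) 0) ^ p)
      ≤ ENNReal.ofReal ((3:ℝ) ^ (p - 1)) *
        ∑' k : ℕ, (ENNReal.ofReal ((max (b k).re 0) ^ p)
          + 2 * ENNReal.ofReal (|(a k).re - 1| ^ p))) := by
  obtain ⟨hd, hVx, he⟩ := core u a b lam M ha hb hu heq
  have hB0 : ∀ k, 0 ≤ max (b k).re 0 := fun k => le_max_right _ _
  have hA0 : ∀ k, 0 ≤ |(a k).re - 1| := fun k => abs_nonneg _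
  have hsum := V_sum (fun k => max (b k).re 0) (fun k => |(a k).re - 1|) hB0 hA0
  set V := Vpot (fun k => max (b k).re 0) (fun k => |(a k).re - 1|) with hV
  have hV0 : ∀ k, 0 ≤ V k := by
    intro k
    simp only [hV, Vpot]
    split_ifs
    · have := hB0 k
      have := hA0 k
      positivity
    · have := hB0 k
      have := hA0 k
      have := hA0 (k-1)
      positivity
  constructor
  · have h1 := al_step p (max (lam.re - 2) 0) hp (le_max_right _ _) V hV0 (by
      intro t h0 ht hs
      have hh := half_bound (fun k => ‖u k‖) V hu hd hVx _ he t hs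
      rcases max_cases (lam.re - 2) 0 with ⟨h, _⟩ | ⟨h, _⟩
      · rw [h]; exact hh
      · rw [h] at ht; linarith)
    have h2 := hsum (p + 1/2) (by linarith)
    rw [show p + 1/2 - 1 = p - 1/2 by ring] at h2
    refine h1.trans ((mul_le_mul_right h2 _).trans (le_of_eq ?_))
    rw [← mul_assoc, cp_eq, ← ENNReal.ofReal_mul]
    have := Real.Gamma_pos_of_pos (show 0 < p + 1 by linarith)
    have := Real.Gamma_pos_of_pos (show 0 < p + 3/2 by linarith)
    have := Real.Gamma_pos_of_pos (show (0:ℝ) < 3/2 by norm_num)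
    have := Real.Gamma_pos_of_pos (show (0:ℝ) < 2 by norm_num)
    positivity
  · refine le_trans ?_ (hsum p hp)
    have hD : 0 ≤ ‖u 0‖ ^ 2 + ∑' k, (‖u (k+1)‖ - ‖u k‖) ^ 2 :=
      add_nonneg (sq_nonneg _) (tsum_nonneg fun k => sq_nonneg _)
    obtain ⟨k, hk⟩ := exists_ge (fun k => ‖u k‖) V hu hVx (lam.re - 2) (by linarith)
    refine le_trans ?_ (ENNReal.le_tsum k)
    apply ENNReal.ofReal_le_ofReal
    exact Real.rpow_le_rpow (le_max_right _ _) (max_le hk (hV0 k)) (by linarith)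

lemma bounded_of_tendsto (f : ℕ → ℂ) (z : ℂ) (h : Filter.Tendsto f Filter.atTop (nhds z)) :
    ∃ M, ∀ k, ‖f k‖ ≤ M := by
  obtain ⟨M, hM⟩ := h.norm.bddAbove_range
  exact ⟨M, fun k => hM ⟨k, rfl⟩⟩

theorem single_eigenvalue_complex_re
    (a b : ℕ → ℂ)
    (ha : Filter.Tendsto a Filter.atTop (nhds 1))
    (hb : Filter.Tendsto b Filter.atTop (nhds 0))
    (J : l2 →L[ℂ] l2) (hJ : IsJacobi J a b)
    (p : ℝ) (hp : 1 ≤ p)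
    (lam : ℂ) (hlam : HasEigen J lam) :
    (ENNReal.ofReal ((max (lam.re - 2) 0) ^ p)
      ≤ ENNReal.ofReal (cp p) *
        ∑' k : ℕ, (ENNReal.ofReal ((max (b k).re 0) ^ (p + 1/2))
          + 2 * ENNReal.ofReal (|(a k).re - 1| ^ (p + 1/2))))
    ∧ (ENNReal.ofReal ((max (-(lam.re + 2)) 0) ^ p)
      ≤ ENNReal.ofReal (cp p) *
        ∑' k : ℕ, (ENNReal.ofReal ((max (-(b k).re) 0) ^ (p + 1/2))
          + 2 * ENNReal.ofReal (|(a k).re - 1| ^ (p + 1/2))))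
    ∧ (ENNReal.ofReal ((max (lam.re - 2) 0) ^ p)
      ≤ ENNReal.ofReal ((3:ℝ) ^ (p - 1)) *
        ∑' k : ℕ, (ENNReal.ofReal ((max (b k).re 0) ^ p)
          + 2 * ENNReal.ofReal (|(a k).re - 1| ^ p)))
    ∧ (ENNReal.ofReal ((max (-(lam.re + 2)) 0) ^ p)
      ≤ ENNReal.ofReal ((3:ℝ) ^ (p - 1)) *
        ∑' k : ℕ, (ENNReal.ofReal ((max (-(b k).re) 0) ^ p)
          + 2 * ENNReal.ofReal (|(a k).re - 1| ^ p))) := by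
  obtain ⟨M₁, hM₁⟩ := bounded_of_tendsto a 1 ha
  obtain ⟨M₂, hM₂⟩ := bounded_of_tendsto b 0 hb
  have hMa : ∀ k, ‖a k‖ ≤ max M₁ M₂ := fun k => (hM₁ k).trans (le_max_left _ _)
  have hMb : ∀ k, ‖b k‖ ≤ max M₁ M₂ := fun k => (hM₂ k).trans (le_max_right _ _)
  obtain ⟨w, hw0, hw⟩ := hlam
  have hn : ‖w‖ ≠ 0 := norm_ne_zero_iff.2 hw0
  obtain ⟨v, hv1, hv⟩ : ∃ v : l2, ‖v‖ = 1 ∧ J v = lam • v := by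
    refine ⟨((‖w‖⁻¹ : ℝ) : ℂ) • w, ?_, ?_⟩
    · rw [norm_smul]
      simp [hn]
    · rw [map_smul, hw, smul_comm]
  have hu : HasSum (fun k => ‖(v : ∀ _ : ℕ, ℂ) k‖ ^ 2) 1 := by
    have := lp.hasSum_norm (p := 2) (by norm_num) v
    simpa [hv1] using this
  have heq : ∀ k, lam * (v : ∀ _ : ℕ, ℂ) k =
      (if k = 0 then 0 else a (k - 1) * (v : ∀ _ : ℕ, ℂ) (k - 1)) + b k * (v : ∀ _ : ℕ, ℂ) k
      + a k * (v : ∀ _ : ℕ, ℂ) (k + 1) := by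
    intro k
    rw [← hJ v k, hv]
    simp
  obtain ⟨h1, h3⟩ := plus_case (fun k => (v : ∀ _ : ℕ, ℂ) k) a b lam _ hMa hMb hu heq p hp
  obtain ⟨h2, h4⟩ := plus_case (fun k => (-1) ^ k * (v : ∀ _ : ℕ, ℂ) k) a (fun k => - b k) (-lam) _
    hMa (by simpa using hMb) (by simpa using hu) (by
      intro k
      have := heq k
      rcases k with _ | k
      · simp at this ⊢
        linear_combination -this
      · simp at this ⊢
        linear_combination (-1) ^ k * this) p hp
  have e1 : -lam.re - 2 = -(lam.re + 2) := by ring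
  simp only [Complex.neg_re, e1] at h2 h4
  exact ⟨h1, h2, h3, h4⟩
end
end
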